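/- arXiv:1612.03592 — 5 statements merged into one kernel-verified Lean document; each statement's English description precedes it below -/
import Mathlib

section
/- Let n and r be positive integers with r ≤ n, and let M be a nonempty collection of r-element subsets of {1,…,n} that forms the set of bases of a matroid (i.e., M satisfies the basis exchange axiom). For B ∈ M let e_B ∈ ℝⁿ denote the characteristic vector of B, and let P_M be the convex hull of {e_B : B ∈ M}. Then every edge of P_M is parallel to e_i − e_j for some i ≠ j; concretely: if B, B' ∈ M are distinct and the segment with endpoints e_B and e_B' is an extreme subset (face) of P_M, then |B \ B'| = 1, so that e_B − e_B' = e_i − e_j for some i ∈ B \ B' and j ∈ B' \ B. -/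
/-- **Symmetric basis exchange**: an element of `B \ B'` can be swapped with an element of
`B' \ B` so that both resulting sets are bases. -/
theorem Matroid.IsBase.exists_symmetric_exchange {α : Type*} {N : Matroid α} {B B' : Set α}
    (hB : N.IsBase B) (hB' : N.IsBase B') {i : α} (hi : i ∈ B \ B') :
    ∃ j ∈ B' \ B, N.IsBase (insert j (B \ {i})) ∧ N.IsBase (insert i (B' \ {j})) := by
  have hiE : i ∈ N.E := hB.subset_ground hi.1
  have hicl : i ∈ N.closure B' := by rwa [hB'.closure_eq]
  have hC := hB'.fundCircuit_isCircuit hiE hi.2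
  obtain ⟨j, ⟨hjC, hji⟩, hj⟩ : ∃ j ∈ N.fundCircuit i B' \ {i}, j ∉ N.closure (B \ {i}) := by
    by_contra! h
    exact hB.indep.notMem_closure_sdiff_of_mem hi.1 <|
      N.closure_subset_closure_of_subset_closure h <|
        hC.mem_closure_sdiff_singleton_of_mem (N.mem_fundCircuit i B')
  have hjB' : j ∈ B' := (N.fundCircuit_subset_insert i B' hjC).resolve_left hji
  have hjE : j ∈ N.E := hB'.subset_ground hjB'
  have hjB : j ∉ B := fun h ↦
    hj (N.mem_closure_of_mem ⟨h, hji⟩ (Set.sdiff_subset.trans hB.subset_ground))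
  refine ⟨j, ⟨hjB', hjB⟩, hB.exchange_base_of_notMem_closure hi.1 hj, ?_⟩
  rw [Set.insert_sdiff_singleton_comm (Ne.symm hji)]
  exact hB'.exchange_isBase_of_indep' hjB' hi.2 <|
    (hB'.indep.mem_fundCircuit_iff hicl hi.2).1 hjC

/-- Symmetric basis exchange for a collection of finite sets satisfying the basis exchange
axiom. -/
theorem exists_symmetric_exchange_of_exchange {α : Type*} [Finite α] [DecidableEq α]
    {M : Set (Finset α)}
    (hexch : ∀ B ∈ M, ∀ B' ∈ M, ∀ i ∈ B \ B', ∃ j ∈ B' \ B, insert j (B.erase i) ∈ M)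
    {B B' : Finset α} (hB : B ∈ M) (hB' : B' ∈ M) {i : α} (hi : i ∈ B \ B') :
    ∃ j ∈ B' \ B, insert j (B.erase i) ∈ M ∧ insert i (B'.erase j) ∈ M := by
  let N : Matroid α := Matroid.ofIsBaseOfFinite (E := Set.univ) Set.finite_univ
    (fun X ↦ ∃ A ∈ M, (A : Set α) = X) ⟨B, B, hB, rfl⟩
    (by
      rintro _ _ ⟨A, hA, rfl⟩ ⟨A', hA', rfl⟩ a ha
      obtain ⟨b, hb, hbM⟩ := hexch A hA A' hA' a (by simpa using ha)
      exact ⟨b, by simpa using hb, _, hbM, by simp⟩)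
    (fun _ _ ↦ Set.subset_univ _)
  have hN (A : Finset α) : N.IsBase A ↔ A ∈ M :=
    ⟨fun ⟨_, hA, h⟩ ↦ Finset.coe_injective h ▸ hA, fun h ↦ ⟨A, h, rfl⟩⟩
  obtain ⟨j, hj, h₁, h₂⟩ := ((hN B).2 hB).exists_symmetric_exchange ((hN B').2 hB')
    (i := i) (by simpa using hi)
  exact ⟨j, by simpa using hj, (hN _).1 (by simpa using h₁), (hN _).1 (by simpa using h₂)⟩

/-- If `M` is a nonempty collection of `r`-element subsets of `{1,…,n}`
satisfying the basis exchange axiom (i.e. the set of bases of a matroid), then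
every edge of the polytope `P_M = conv {e_B : B ∈ M}` is parallel to
`e_i - e_j` for some `i ≠ j`: whenever the segment between two distinct
vertices `e_B`, `e_B'` is a face (extreme subset) of `P_M`, one has
`|B \ B'| = 1`. -/
theorem matroid_polytope_edges (n r : ℕ) (hr : 0 < r) (hrn : r ≤ n)
    (M : Set (Finset (Fin n))) (hMne : M.Nonempty)
    (hcard : ∀ B ∈ M, B.card = r)
    (hexch : ∀ B ∈ M, ∀ B' ∈ M, ∀ i ∈ B \ B',
      ∃ j ∈ B' \ B, insert j (B.erase i) ∈ M)
    (eB : Finset (Fin n) → (Fin n → ℝ))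
    (heB : ∀ (B : Finset (Fin n)) (i : Fin n), eB B i = if i ∈ B then 1 else 0)
    (B B' : Finset (Fin n)) (hB : B ∈ M) (hB' : B' ∈ M) (hne : B ≠ B')
    (hedge : IsExtreme ℝ (convexHull ℝ (eB '' M)) (segment ℝ (eB B) (eB B'))) :
    (B \ B').card = 1 := by
  obtain ⟨i, hi⟩ : (B \ B').Nonempty := by
    rw [Finset.sdiff_nonempty]
    exact fun h ↦ hne (Finset.eq_of_subset_of_card_le h (by rw [hcard B hB, hcard B' hB']))
  obtain ⟨j, hj, h₁, h₂⟩ := exists_symmetric_exchange_of_exchange hexch hB hB' hi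
  rw [Finset.mem_sdiff] at hi hj
  have hsum : eB (insert j (B.erase i)) + eB (insert i (B'.erase j)) = eB B + eB B' := by
    ext k
    simp only [Pi.add_apply, heB, Finset.mem_insert, Finset.mem_erase]
    by_cases hki : k = i
    · subst hki
      have : k ≠ j := by rintro rfl; exact hj.2 hi.1
      simp [hi, this]
    · by_cases hkj : k = j
      · subst hkj
        simp [hj, hki]
      · simp [hki, hkj]
  have hmem : eB (insert j (B.erase i)) ∈ segment ℝ (eB B) (eB B') := by
    refine hedge.left_mem_of_mem_openSegment
      (subset_convexHull ℝ _ ⟨_, h₁, rfl⟩) (subset_convexHull ℝ _ ⟨_, h₂, rfl⟩)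
      (z := (1 / 2 : ℝ) • (eB B + eB B'))
      ⟨1 / 2, 1 / 2, by norm_num, by norm_num, by norm_num, by rw [smul_add]⟩
      ⟨1 / 2, 1 / 2, by norm_num, by norm_num, by norm_num, by rw [← hsum, smul_add]⟩
  -- The `i`-th coordinate vanishes, so the point is the endpoint `eB B'`.
  obtain ⟨a, b, -, -, hab, h⟩ := hmem
  have hij : i ≠ j := by rintro rfl; exact hj.2 hi.1
  have ha : a = 0 := by simpa [heB, hi, hij] using congrFun h i
  have hb : b = 1 := by linarith
  rw [Finset.card_eq_one]
  refine ⟨i, Finset.eq_singleton_iff_unique_mem.2 ⟨Finset.mem_sdiff.2 hi, fun k hk ↦ ?_⟩⟩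
  rw [Finset.mem_sdiff] at hk
  by_contra hki
  simpa [ha, hb, heB, hk, hki] using congrFun h k
end

section
/- Let n and r be positive integers with r ≤ n, and let M be a nonempty collection of r-element subsets of {1,…,n}. Suppose that every edge of P_M, the convex hull of the characteristic vectors {e_B : B ∈ M}, is parallel to e_i − e_j for some i ≠ j; concretely, suppose that for all distinct B, B' ∈ M such that the segment with endpoints e_B and e_B' is an extreme subset (face) of P_M, one has |B \ B'| = 1. Then M is the set of bases of a matroid, i.e., M satisfies the basis exchange axiom: for all B, B' ∈ M and all i ∈ B \ B' there exists j ∈ B' \ B with (B \ {i}) ∪ {j} ∈ M. -/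
/-- A segment from `v` to `x` in the direction of an extreme point `p` of a section `Q` of the cone
of `P` at `v` is an extreme subset of `P`, provided `P` does not extend beyond `x`. -/
theorem isExtreme_segment_of_mem_extremePoints {E : Type*} [AddCommGroup E] [Module ℝ E]
    {P Q : Set E} {v x p : E} (h : E →ₗ[ℝ] ℝ) (hP : Convex ℝ P) (hv : v ∈ P) (hx : x ∈ P)
    (hPQ : ∀ y ∈ P, 0 ≤ h (y - v) ∧ ∃ q ∈ Q, y - v = h (y - v) • q)
    (hp : p ∈ Q.extremePoints ℝ) (hxp : x - v = h (x - v) • p)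
    (hQ : ∀ q ∈ Q, h q = 1) (hpos : 0 < h (x - v))
    (hbound : ∀ y ∈ P, ∀ t : ℝ, y - v = t • p → t ≤ h (x - v)) :
    IsExtreme ℝ P (segment ℝ v x) := by
  have mem_segment : ∀ y ∈ P, y - v = h (y - v) • p → y ∈ segment ℝ v x := by
    intro y hy hyp
    rw [segment_eq_image']
    refine ⟨h (y - v) / h (x - v),
      ⟨div_nonneg (hPQ y hy).1 hpos.le, (div_le_one hpos).2 (hbound y hy _ hyp)⟩, ?_⟩
    dsimp only
    rw [hxp, smul_smul, map_smul, hQ p hp.1, smul_eq_mul, mul_one, div_mul_cancel₀ _ hpos.ne', ← hyp]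
    abel
  refine ⟨hP.segment_subset hv hx, ?_⟩
  intro y hy z hz w hw hwyz
  apply mem_segment y hy
  obtain ⟨hy0, q, hq, hyq⟩ := hPQ y hy
  obtain ⟨hz0, q', hq', hzq⟩ := hPQ z hz
  generalize h (y - v) = s at *
  generalize h (z - v) = t at *
  obtain ⟨c, -, rfl⟩ := (segment_eq_image' ℝ v x ▸ hw)
  obtain ⟨a, b, ha, hb, hab, hw'⟩ := hwyz
  have key : (a * s) • q + (b * t) • q' = (c * h (x - v)) • p := by
    rw [mul_smul, mul_smul, mul_smul, ← hyq, ← hzq, ← hxp]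
    have : a • (y - v) + b • (z - v) = (a • y + b • z) - (a + b) • v := by module
    rw [this, hw', hab]
    module
  have hsum : a * s + b * t = c * h (x - v) := by
    simpa [hQ q hq, hQ q' hq', hQ p hp.1] using congrArg h key
  rcases hy0.eq_or_lt with rfl | hs
  · rw [hyq, zero_smul, zero_smul]
  have has : 0 < a * s := mul_pos ha hs
  have hqp : q = p := by
    rcases hz0.eq_or_lt with rfl | ht
    · rw [← hsum, mul_zero, zero_smul, add_zero, add_zero] at key
      exact smul_right_injective E has.ne' key
    · have hbt : 0 < b * t := mul_pos hb ht
      have hc : 0 < a * s + b * t := add_pos has hbt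
      refine hp.2 hq hq' ⟨a * s / (a * s + b * t), b * t / (a * s + b * t), div_pos has hc,
        div_pos hbt hc, by rw [← add_div, div_self hc.ne'], ?_⟩
      rw [← hsum] at key
      rw [div_eq_inv_mul, div_eq_inv_mul, mul_smul _ (a * s), mul_smul _ (b * t), ← smul_add, key,
        inv_smul_smul₀ hc.ne']
  rw [hyq, hqp]

/-- Every point of a convex hull is seen from `v` in the direction of a point of the section, at
height one, of the cone at `v`. -/
theorem exists_mem_convexHull_radial {E : Type*} [AddCommGroup E] [Module ℝ E]
    {S : Set E} {v : E} (h : E →ₗ[ℝ] ℝ) (hS : ∀ x ∈ S, x ≠ v → 0 < h (x - v))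
    (hne : (S \ {v}).Nonempty) :
    ∀ y ∈ convexHull ℝ S, 0 ≤ h (y - v) ∧
      ∃ q ∈ convexHull ℝ ((fun x => (h (x - v))⁻¹ • (x - v)) '' (S \ {v})),
        y - v = h (y - v) • q := by
  set Q := convexHull ℝ ((fun x => (h (x - v))⁻¹ • (x - v)) '' (S \ {v}))
  have hQc : Convex ℝ Q := convex_convexHull ℝ _
  have hQne : Q.Nonempty := (hne.image _).convexHull
  refine convexHull_min (t := {y | 0 ≤ h (y - v) ∧ ∃ q ∈ Q, y - v = h (y - v) • q}) ?_ ?_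
  · intro x hx
    by_cases hxv : x = v
    · obtain ⟨q, hq⟩ := hQne
      exact ⟨by simp [hxv], q, hq, by simp [hxv]⟩
    · have hpos := hS x hx hxv
      exact ⟨hpos.le, _, subset_convexHull ℝ _ ⟨x, ⟨hx, hxv⟩, rfl⟩,
        (smul_inv_smul₀ hpos.ne' _).symm⟩
  · rintro y ⟨hy0, q, hq, hyq⟩ z ⟨hz0, q', hq', hzq⟩ a b ha hb hab
    have hsub : a • y + b • z - v = a • (y - v) + b • (z - v) := by
      obtain rfl : b = 1 - a := by linarith
      module
    obtain ⟨m, hm, hmeq⟩ :=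
      hQc.exists_mem_add_smul_eq hq hq' (mul_nonneg ha hy0) (mul_nonneg hb hz0)
    have hval : h (a • y + b • z - v) = a * h (y - v) + b * h (z - v) := by
      rw [hsub]; simp only [map_add, map_smul, smul_eq_mul]
    refine ⟨by rw [hval]; positivity, m, hm, ?_⟩
    rw [hval, hmeq, hsub, mul_smul, mul_smul, ← hyq, ← hzq]

/-- The convex hull of a finite set is the convex hull of its extreme points. -/
theorem Set.Finite.convexHull_extremePoints {E : Type*} [AddCommGroup E] [Module ℝ E]
    [TopologicalSpace E] [T2Space E] [IsTopologicalAddGroup E] [ContinuousSMul ℝ E]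
    [LocallyConvexSpace ℝ E] {S : Set E} (hS : S.Finite) :
    convexHull ℝ ((convexHull ℝ S).extremePoints ℝ) = convexHull ℝ S := by
  have hfin : ((convexHull ℝ S).extremePoints ℝ).Finite :=
    hS.subset extremePoints_convexHull_subset
  rw [← (hfin.isCompact_convexHull ℝ).isClosed.closure_eq]
  exact closure_convexHull_extremePoints (hS.isCompact_convexHull ℝ) (convex_convexHull ℝ S)

/-- If `M` is a nonempty collection of `r`-element subsets of `{1,…,n}` such
that every edge of the polytope `P_M = conv {e_B : B ∈ M}` is parallel to some
`e_i - e_j` (i.e. `|B \ B'| = 1` whenever the segment between the distinct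
vertices `e_B`, `e_B'` is a face of `P_M`), then `M` satisfies the basis
exchange axiom, i.e. `M` is the set of bases of a matroid. -/
theorem matroid_polytope_edges_converse (n r : ℕ) (hr : 0 < r) (hrn : r ≤ n)
    (M : Set (Finset (Fin n))) (hMne : M.Nonempty)
    (hcard : ∀ B ∈ M, B.card = r)
    (eB : Finset (Fin n) → (Fin n → ℝ))
    (heB : ∀ (B : Finset (Fin n)) (i : Fin n), eB B i = if i ∈ B then 1 else 0)
    (hedges : ∀ B ∈ M, ∀ B' ∈ M, B ≠ B' →
      IsExtreme ℝ (convexHull ℝ (eB '' M)) (segment ℝ (eB B) (eB B')) →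
      (B \ B').card = 1) :
    ∀ B ∈ M, ∀ B' ∈ M, ∀ i ∈ B \ B',
      ∃ j ∈ B' \ B, insert j (B.erase i) ∈ M := by
  intro A hA B hB i hi
  obtain ⟨hiA, hiB⟩ := Finset.mem_sdiff.1 hi
  by_contra! hno
  have heBA : ∀ X, eB X = eB A → X = A := fun X hX => by
    ext k
    have := congrFun hX k
    rw [heB, heB] at this
    split_ifs at this <;> simp_all
  -- the height of `e_X` above `e_A` is `|A \ X|`
  let h : (Fin n → ℝ) →ₗ[ℝ] ℝ := -∑ k ∈ A, LinearMap.proj k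
  have hh : ∀ X, h (eB X - eB A) = ((A \ X).card : ℝ) := fun X => by
    have h1 : ∀ k ∈ A, eB A k - eB X k = if k ∉ X then 1 else 0 := fun k hk => by
      rw [heB, heB, if_pos hk]; split_ifs <;> simp_all
    have h2 : h (eB X - eB A) = ∑ k ∈ A, (eB A k - eB X k) := by
      simp [h]
    rw [h2, Finset.sum_congr rfl h1, Finset.sum_boole, Finset.sdiff_eq_filter]
  have hnonempty : ∀ X ∈ M, X ≠ A → (A \ X).Nonempty := fun X hX hXA => by
    rw [Finset.sdiff_nonempty]
    intro hsub
    exact hXA (Finset.eq_of_subset_of_card_le hsub (by rw [hcard A hA, hcard X hX])).symm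
  have hpos : ∀ X ∈ M, X ≠ A → 0 < h (eB X - eB A) := fun X hX hXA => by
    rw [hh]; exact_mod_cast (hnonempty X hX hXA).card_pos
  have hBA : B ≠ A := fun hBA => hiB (hBA ▸ hiA)
  have hSpos : ∀ x ∈ eB '' M, x ≠ eB A → 0 < h (x - eB A) := by
    rintro _ ⟨X, hX, rfl⟩ hXA
    exact hpos X hX fun hXA' => hXA (hXA' ▸ rfl)
  have hBmem : eB B ∈ eB '' M \ {eB A} := ⟨⟨B, hB, rfl⟩, fun hB' => hBA (heBA B hB')⟩
  have hPQ := exists_mem_convexHull_radial h hSpos ⟨_, hBmem⟩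
  set R := (fun x => (h (x - eB A))⁻¹ • (x - eB A)) '' (eB '' M \ {eB A})
  have hQ1 : ∀ q ∈ convexHull ℝ R, h q = 1 := by
    refine convexHull_min (t := {q | h q = 1}) ?_ (convex_hyperplane h.isLinear 1)
    rintro _ ⟨x, ⟨hx, hxA⟩, rfl⟩
    have := (hSpos x hx hxA).ne'
    simp only [Set.mem_ofPred_eq, map_smul, smul_eq_mul]
    exact inv_mul_cancel₀ this
  have hP0 : ∀ y ∈ convexHull ℝ (eB '' M), ∀ k, 0 ≤ y k := by
    intro y hy k
    refine convexHull_min (t := {y : Fin n → ℝ | 0 ≤ y k}) ?_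
      (convex_halfSpace_ge (LinearMap.proj k : (Fin n → ℝ) →ₗ[ℝ] ℝ).isLinear 0) hy
    rintro _ ⟨X, -, rfl⟩
    simp only [Set.mem_ofPred_eq, heB]
    positivity
  have hRfin : R.Finite := ((M.toFinite.image eB).subset Set.sdiff_subset).image _
  -- the functional `x_i + ∑_{j ∉ A ∪ B} x_j` separates `e_B - e_A` from the edge directions at `e_A`
  let f : (Fin n → ℝ) →ₗ[ℝ] ℝ :=
    LinearMap.proj i + ∑ k ∈ (A ∪ B)ᶜ, (LinearMap.proj k : (Fin n → ℝ) →ₗ[ℝ] ℝ)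
  have hf : ∀ X, f (eB X - eB A) = eB X i - 1 + ((X \ (A ∪ B)).card : ℝ) := fun X => by
    have h1 : ∀ k ∈ (A ∪ B)ᶜ, eB X k - eB A k = if k ∈ X then 1 else 0 := fun k hk => by
      rw [heB, heB, if_neg (fun hkA => by simp_all : k ∉ A), sub_zero]
    have h2 : f (eB X - eB A) = eB X i - eB A i + ∑ k ∈ (A ∪ B)ᶜ, (eB X k - eB A k) := by
      simp [f]
    rw [h2, Finset.sum_congr rfl h1, Finset.sum_boole, heB A, if_pos hiA]
    congr 3
    ext k
    simp [and_comm]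
  have hfQ : ∀ q ∈ convexHull ℝ R, 0 ≤ f q := by
    rw [← hRfin.convexHull_extremePoints]
    refine convexHull_min (t := {q | 0 ≤ f q}) ?_ (convex_halfSpace_ge f.isLinear 0)
    intro p hp
    obtain ⟨_, ⟨⟨X, hX, rfl⟩, hXA'⟩, rfl⟩ := extremePoints_convexHull_subset hp
    have hXA : X ≠ A := fun hXA => hXA' (hXA ▸ rfl)
    have hpX := hpos X hX hXA
    have hcard1 : (A \ X).card = 1 := by
      refine hedges A hA X hX hXA.symm (isExtreme_segment_of_mem_extremePoints h
        (convex_convexHull ℝ _) (subset_convexHull ℝ _ ⟨A, hA, rfl⟩)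
        (subset_convexHull ℝ _ ⟨X, hX, rfl⟩) hPQ hp (smul_inv_smul₀ hpX.ne' _).symm hQ1 hpX ?_)
      intro y hy t hyt
      obtain ⟨k, hk⟩ := hnonempty X hX hXA
      obtain ⟨hkA, hkX⟩ := Finset.mem_sdiff.1 hk
      have hk' := congrFun hyt k
      simp only [Pi.sub_apply, Pi.smul_apply, smul_eq_mul, heB, if_pos hkA, if_neg hkX] at hk'
      have hle : t * (h (eB X - eB A))⁻¹ ≤ 1 := by linarith [hP0 y hy k]
      rwa [← div_eq_mul_inv, div_le_one hpX] at hle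
    simp only [Set.mem_ofPred_eq, map_smul f, smul_eq_mul]
    refine mul_nonneg (inv_nonneg.2 hpX.le) ?_
    rw [hf, heB]
    split_ifs with hiX
    · simp
    suffices (X \ (A ∪ B)).Nonempty by
      have : (1 : ℝ) ≤ ((X \ (A ∪ B)).card : ℝ) := by exact_mod_cast this.card_pos
      linarith
    have hAX : A \ X = {i} := by
      obtain ⟨k, hk⟩ := Finset.card_eq_one.1 hcard1
      have : i ∈ A \ X := Finset.mem_sdiff.2 ⟨hiA, hiX⟩
      rw [hk, Finset.mem_singleton] at this
      rw [hk, this]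
    obtain ⟨j, hj⟩ := Finset.card_eq_one.1
      ((Finset.card_sdiff_comm ((hcard X hX).trans (hcard A hA).symm)).trans hcard1)
    have hXeq : X = insert j (A.erase i) := by
      ext k
      have h1 := Finset.ext_iff.1 hAX k
      have h2 := Finset.ext_iff.1 hj k
      simp only [Finset.mem_sdiff, Finset.mem_singleton] at h1 h2
      simp only [Finset.mem_insert, Finset.mem_erase]
      tauto
    have hjX : j ∈ X \ A := hj ▸ Finset.mem_singleton_self j
    rw [Finset.mem_sdiff] at hjX
    refine ⟨j, Finset.mem_sdiff.2 ⟨hjX.1, fun hjAB => ?_⟩⟩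
    have hjB : j ∈ B := (Finset.mem_union.1 hjAB).resolve_left hjX.2
    exact hno j (Finset.mem_sdiff.2 ⟨hjB, hjX.2⟩) (hXeq ▸ hX)
  have hfB := hfQ _ (subset_convexHull ℝ _ ⟨_, hBmem, rfl⟩)
  have hBpos := hpos B hB hBA
  simp only [map_smul f, smul_eq_mul] at hfB
  have := nonneg_of_mul_nonneg_right hfB (inv_pos.2 hBpos)
  rw [hf, heB, if_neg hiB, Finset.sdiff_eq_empty_iff_subset.2 Finset.subset_union_right] at this
  norm_num at this
end

section
/- Let n and r be integers with 0 < r < n, and let B and B' be distinct r-element subsets of {1,…,n}. Then the segment with endpoints e_B and e_B' is an extreme subset (edge) of the hypersimplex Δ(r,n) if and only if |B \ B'| = 1, i.e., if and only if e_B − e_B' = e_i − e_j for some i ≠ j. -/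
/-- Points of the hypersimplex have coordinates in `[0, 1]` with sum `r`. -/
theorem convexHull_indicators_subset {ι : Type*} [Fintype ι] [DecidableEq ι] (r : ℕ)
    (e : Finset ι → ι → ℝ) (he : ∀ B i, e B i = if i ∈ B then 1 else 0) :
    convexHull ℝ (e '' {C : Finset ι | C.card = r}) ⊆
      {x | (∀ i, 0 ≤ x i ∧ x i ≤ 1) ∧ ∑ i, x i = r} := by
  refine convexHull_min ?_ ?_
  · rintro _ ⟨C, hC, rfl⟩
    refine ⟨fun i => ?_, ?_⟩
    · rw [he]
      split_ifs <;> norm_num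
    · simp only [Set.mem_ofPred_eq] at hC
      simp [he, hC]
  · rintro x ⟨hx, hxs⟩ y ⟨hy, hys⟩ a b ha hb hab
    refine ⟨fun i => ?_, ?_⟩
    · have h := convex_Icc (0 : ℝ) 1 (hx i) (hy i) ha hb hab
      simpa using h
    · simp only [Pi.add_apply, Pi.smul_apply, smul_eq_mul, Finset.sum_add_distrib,
        ← Finset.mul_sum, hxs, hys, ← add_mul, hab, one_mul]

/-- If a strict convex combination of two numbers in `[0, 1]` is `0` or `1`, then so is the
first number. -/
theorem eq_of_strict_combination_eq {a b x y c : ℝ} (ha : 0 < a) (hb : 0 < b) (hab : a + b = 1)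
    (hx : 0 ≤ x ∧ x ≤ 1) (hy : 0 ≤ y ∧ y ≤ 1) (hc : c = 0 ∨ c = 1) (h : a * x + b * y = c) :
    x = c := by
  rcases hc with rfl | rfl
  · nlinarith [mul_nonneg ha.le hx.1, mul_nonneg hb.le hy.1]
  · nlinarith [mul_nonneg ha.le (sub_nonneg.2 hx.2), mul_nonneg hb.le (sub_nonneg.2 hy.2)]

/-- For `0 < r < n` and distinct `r`-element subsets `B, B'` of `{1,…,n}`, the
segment between `e_B` and `e_B'` is a face (extreme subset) of the hypersimplex
`Δ(r,n) = conv {e_C : |C| = r}` if and only if `|B \ B'| = 1`, i.e. if and only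
if `e_B - e_B' = e_i - e_j` for some `i ≠ j`. -/
theorem hypersimplex_edge_iff (n r : ℕ) (hr : 0 < r) (hrn : r < n)
    (eB : Finset (Fin n) → (Fin n → ℝ))
    (heB : ∀ (B : Finset (Fin n)) (i : Fin n), eB B i = if i ∈ B then 1 else 0)
    (B B' : Finset (Fin n)) (hB : B.card = r) (hB' : B'.card = r)
    (hne : B ≠ B') :
    IsExtreme ℝ (convexHull ℝ (eB '' {C : Finset (Fin n) | C.card = r}))
        (segment ℝ (eB B) (eB B'))
      ↔ (B \ B').card = 1 := by
  have hcard : (B \ B').card = (B' \ B).card := Finset.card_sdiff_comm (hB.trans hB'.symm)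
  have hmem : ∀ C : Finset (Fin n), C.card = r →
      eB C ∈ convexHull ℝ (eB '' {C : Finset (Fin n) | C.card = r}) :=
    fun C hC => subset_convexHull ℝ _ ⟨C, hC, rfl⟩
  constructor
  · intro hext
    by_contra hcon
    have hpos : (B \ B').card ≠ 0 := fun h => hne <|
      Finset.eq_of_subset_of_card_le
        (Finset.sdiff_eq_empty_iff_subset.1 (Finset.card_eq_zero.1 h)) (by omega)
    obtain ⟨i, hi, k, hk, hik⟩ := Finset.one_lt_card.1 (show 1 < (B \ B').card by omega)
    obtain ⟨j, hj⟩ := Finset.card_pos.1 (show 0 < (B' \ B).card by omega)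
    rw [Finset.mem_sdiff] at hi hk hj
    have hC : (insert j (B.erase i)).card = r := by
      rw [Finset.card_insert_of_notMem (by simp [hj.2]), Finset.card_erase_of_mem hi.1]
      omega
    have hC' : (insert i (B'.erase j)).card = r := by
      rw [Finset.card_insert_of_notMem (by simp [hi.2]), Finset.card_erase_of_mem hj.1]
      omega
    have hsum : eB (insert j (B.erase i)) + eB (insert i (B'.erase j)) = eB B + eB B' := by
      funext l
      simp only [Pi.add_apply, heB, Finset.mem_insert, Finset.mem_erase]
      by_cases hli : l = i
      · subst hli
        have : l ≠ j := fun h => hj.2 (h ▸ hi.1)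
        simp [hi, this]
      · by_cases hlj : l = j
        · subst hlj
          simp [hj, hli]
        · simp [hli, hlj]
    have hz : (1 / 2 : ℝ) • eB B + (1 / 2 : ℝ) • eB B' ∈ segment ℝ (eB B) (eB B') :=
      ⟨1 / 2, 1 / 2, by norm_num, by norm_num, by norm_num, rfl⟩
    obtain ⟨a, b, -, -, -, h⟩ := hext.left_mem_of_mem_openSegment (hmem _ hC) (hmem _ hC') hz
      ⟨1 / 2, 1 / 2, by norm_num, by norm_num, by norm_num, by
        rw [← smul_add, ← smul_add, hsum]⟩
    have hai := congrFun h i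
    have hak := congrFun h k
    have hij : i ≠ j := fun h => hj.2 (h ▸ hi.1)
    simp [heB, hi, hij] at hai
    simp [heB, hk, hik.symm] at hak
    linarith
  · intro hone
    obtain ⟨i, hi⟩ := Finset.card_eq_one.1 hone
    obtain ⟨j, hj⟩ := Finset.card_eq_one.1 (hcard.symm.trans hone)
    have hi' : i ∈ B ∧ i ∉ B' := Finset.mem_sdiff.1 (by simp [hi])
    have hj' : j ∈ B' ∧ j ∉ B := Finset.mem_sdiff.1 (by simp [hj])
    have hij : i ≠ j := fun h => hj'.2 (h ▸ hi'.1)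
    have hoff : ∀ l, l ≠ i → l ≠ j → eB B' l = eB B l := by
      intro l hli hlj
      have h1 : l ∉ B \ B' := by simpa [hi] using hli
      have h2 : l ∉ B' \ B := by simpa [hj] using hlj
      simp only [Finset.mem_sdiff, not_and, not_not] at h1 h2
      simp only [heB, show l ∈ B' ↔ l ∈ B from ⟨h2, h1⟩]
    refine ⟨(convex_convexHull ℝ _).segment_subset (hmem B hB) (hmem B' hB'), ?_⟩
    rintro x hx y hy z ⟨s, t, -, -, hst, rfl⟩ ⟨a, b, ha, hb, hab, hz⟩
    obtain ⟨hx01, hxs⟩ := convexHull_indicators_subset r eB heB hx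
    obtain ⟨hy01, -⟩ := convexHull_indicators_subset r eB heB hy
    obtain ⟨-, hBs⟩ := convexHull_indicators_subset r eB heB (hmem B hB)
    have hxl : ∀ l, l ≠ i → l ≠ j → x l = eB B l := by
      intro l hli hlj
      refine eq_of_strict_combination_eq ha hb hab (hx01 l) (hy01 l) ?_ ?_
      · rw [heB]
        split_ifs <;> simp
      · have h := congrFun hz l
        simp only [Pi.add_apply, Pi.smul_apply, smul_eq_mul, hoff l hli hlj] at h
        rw [h, ← add_mul, hst, one_mul]
    have hxij : x i + x j = 1 := by
      have h0 : ∑ l, (x l - eB B l) = 0 := by rw [Finset.sum_sub_distrib, hxs, hBs, sub_self]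
      rw [Fintype.sum_eq_add i j hij fun l hl => sub_eq_zero.2 (hxl l hl.1 hl.2)] at h0
      simp only [heB, hi'.1, hj'.2, if_true, if_false] at h0
      linarith
    refine ⟨x i, x j, (hx01 i).1, (hx01 j).1, hxij, ?_⟩
    funext l
    simp only [Pi.add_apply, Pi.smul_apply, smul_eq_mul]
    by_cases hli : l = i
    · subst hli
      simp [heB, hi']
    · by_cases hlj : l = j
      · subst hlj
        simp [heB, hj']
      · rw [hoff l hli hlj, hxl l hli hlj, ← add_mul, hxij, one_mul]
end

section
/- Let M be a nonempty collection of r-element subsets of {1,…,n} and let v : M → ℝ satisfy the valuated matroid (Dress–Wenzel) exchange axiom: for all B, B' ∈ M and all i ∈ B \ B', there exists j ∈ B' \ B such that (B \ {i}) ∪ {j} ∈ M, (B' \ {j}) ∪ {i} ∈ M, and v(B) + v(B') ≥ v((B \ {i}) ∪ {j}) + v((B' \ {j}) ∪ {i}). For x ∈ ℝⁿ set M_x := {B ∈ M : v(B) − Σ_{i∈B} x_i is minimal among all elements of M}. Then M_x itself satisfies the same exchange property: for all B, B' ∈ M_x and all i ∈ B \ B' there exists j ∈ B' \ B with both (B \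 {i}) ∪ {j} and (B' \ {j}) ∪ {i} in M_x. In particular, M_x is the set of bases of a matroid. -/
/-- Exchanging `i ∈ B` for `j ∉ B` changes the weight of `B` by `x j - x i`. -/
lemma sum_insert_erase_eq {α : Type*} [DecidableEq α] (x : α → ℝ) {B : Finset α} {i j : α}
    (hi : i ∈ B) (hj : j ∉ B) :
    ∑ k ∈ insert j (B.erase i), x k = ∑ k ∈ B, x k + x j - x i := by
  rw [Finset.sum_insert fun h ↦ hj (Finset.mem_of_mem_erase h),
    ← Finset.add_sum_erase B x hi]
  ring

/-- Let `(M, v)` be a valuated matroid (minimum convention): `M` a nonempty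
collection of `r`-element subsets of `{1,…,n}` and `v` satisfying the
Dress–Wenzel exchange axiom. For `x ∈ ℝⁿ`, the collection
`M_x = {B ∈ M : v(B) - ∑_{i ∈ B} xᵢ minimal}` again satisfies the (strong)
exchange property; in particular it is the set of bases of a matroid. -/
theorem valuated_matroid_Mx_exchange (n r : ℕ)
    (M : Set (Finset (Fin n))) (hMne : M.Nonempty)
    (hcard : ∀ B ∈ M, B.card = r)
    (v : Finset (Fin n) → ℝ)
    (hDW : ∀ B ∈ M, ∀ B' ∈ M, ∀ i ∈ B \ B', ∃ j ∈ B' \ B,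
      insert j (B.erase i) ∈ M ∧ insert i (B'.erase j) ∈ M ∧
      v (insert j (B.erase i)) + v (insert i (B'.erase j)) ≤ v B + v B')
    (x : Fin n → ℝ)
    (Mx : Set (Finset (Fin n)))
    (hMx : Mx = {B ∈ M | ∀ B' ∈ M,
      v B - ∑ i ∈ B, x i ≤ v B' - ∑ i ∈ B', x i}) :
    ∀ B ∈ Mx, ∀ B' ∈ Mx, ∀ i ∈ B \ B',
      ∃ j ∈ B' \ B, insert j (B.erase i) ∈ Mx ∧ insert i (B'.erase j) ∈ Mx := by
  subst hMx
  rintro B ⟨hB, hBmin⟩ B' ⟨hB', hBmin'⟩ i hi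
  obtain ⟨j, hj, hC, hC', hle⟩ := hDW B hB B' hB' i hi
  refine ⟨j, hj, ?_⟩
  rw [Finset.mem_sdiff] at hi hj
  have hsum := sum_insert_erase_eq x hi.1 hj.2
  have hsum' := sum_insert_erase_eq x hj.1 hi.2
  have hmin := hBmin _ hC
  have hmin' := hBmin' _ hC'
  exact ⟨⟨hC, fun D hD ↦ by linarith [hBmin D hD]⟩,
    ⟨hC', fun D hD ↦ by linarith [hBmin' D hD]⟩⟩
end

section
/- Let M be the set of bases of a matroid of rank r on the ground set {1,…,n}, so that every element of M is an r-element subset. Define the corank function v_M on all r-element subsets B of {1,…,n} by v_M(B) := r − max_{B' ∈ M} |B ∩ B'|. Then v_M satisfies the valuated matroid (Dress–Wenzel) exchange axiom on the collection of all r-element subsets: for all r-element subsets A, B of {1,…,n} and all i ∈ A \ B, there exists j ∈ B \ A with v_M(A) + v_M(B) ≥ v_M((A \ {i}) ∪ {j}) + v_M((B \ {j}) ∪ {i}). -/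
/-- The properties of a matroid rank function, stated for finite sets: it is monotone, adding an
element raises it by at most one, and it is submodular. -/
structure IsMatroidRank {α : Type*} [DecidableEq α] (ρ : Finset α → ℕ) : Prop where
  mono : Monotone ρ
  insert_le : ∀ e X, ρ (insert e X) ≤ ρ X + 1
  submodular : ∀ X Y, ρ (X ∩ Y) + ρ (X ∪ Y) ≤ ρ X + ρ Y

namespace IsMatroidRank

variable {α : Type*} [DecidableEq α] {ρ : Finset α → ℕ}

lemma insert_add_le_of_subset (h : IsMatroidRank ρ) (e : α) {X Y : Finset α} (hXY : X ⊆ Y) :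
    ρ (insert e Y) + ρ X ≤ ρ Y + ρ (insert e X) := by
  have hsub := h.submodular (insert e X) Y
  have hinter : ρ X ≤ ρ (insert e X ∩ Y) :=
    h.mono (Finset.subset_inter (Finset.subset_insert e X) hXY)
  have hunion : insert e X ∪ Y = insert e Y := by
    rw [Finset.insert_union, Finset.union_eq_right.2 hXY]
  rw [hunion] at hsub
  omega

lemma union_le_add_card (h : IsMatroidRank ρ) (X S : Finset α) :
    ρ (X ∪ S) ≤ ρ X + S.card := by
  induction S using Finset.induction_on with
  | empty => simp
  | insert e S he ih =>
    have := h.insert_le e (X ∪ S)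
    rw [Finset.union_insert, Finset.card_insert_of_notMem he]
    omega

lemma union_le_of_forall_insert_le (h : IsMatroidRank ρ) {X T : Finset α}
    (hT : ∀ t ∈ T, ρ (insert t X) ≤ ρ X) : ρ (X ∪ T) ≤ ρ X := by
  induction T using Finset.induction_on with
  | empty => simp
  | insert e T he ih =>
    have hle := ih fun t ht => hT t (Finset.mem_insert_of_mem ht)
    have hins := hT e (Finset.mem_insert_self e T)
    have := h.insert_add_le_of_subset e (Finset.subset_union_left : X ⊆ X ∪ T)
    rw [Finset.union_insert]
    omega

/-- Deleting a set of coloops lowers the rank by the number of deleted elements. -/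
lemma sdiff_add_card_le (h : IsMatroidRank ρ) {Y S : Finset α} (hSY : S ⊆ Y)
    (hS : ∀ s ∈ S, ρ (Y.erase s) + 1 ≤ ρ Y) : ρ (Y \ S) + S.card ≤ ρ Y := by
  induction S using Finset.induction_on with
  | empty => simp
  | insert e S he ih =>
    have heY : e ∈ Y := hSY (Finset.mem_insert_self e S)
    have hle := ih ((Finset.subset_insert e S).trans hSY)
      fun s hs => hS s (Finset.mem_insert_of_mem hs)
    have hcol := hS e (Finset.mem_insert_self e S)
    have hsub : Y \ insert e S ⊆ Y.erase e := by grind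
    have hins : insert e (Y \ insert e S) = Y \ S := by grind
    have := h.insert_add_le_of_subset e hsub
    rw [Finset.insert_erase heY, hins] at this
    rw [Finset.card_insert_of_notMem he]
    omega

/-- If every element of `B \ A` is spanned by `A - i` or is a coloop of `B + i`, and `i` is
spanned by `B`, then `i` is spanned by `A - i`. -/
lemma le_erase_of_spanned_or_coloop (h : IsMatroidRank ρ) {A B : Finset α} {i : α}
    (hiB : i ∉ B) (hspan : ρ (insert i B) ≤ ρ B)
    (hj : ∀ j ∈ B \ A, ρ (insert j (A.erase i)) ≤ ρ (A.erase i) ∨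
      ρ ((insert i B).erase j) + 1 ≤ ρ (insert i B)) :
    ρ A ≤ ρ (A.erase i) := by
  let S := (B \ A).filter fun j => ρ ((insert i B).erase j) + 1 ≤ ρ (insert i B)
  have hSB : S ⊆ B := (Finset.filter_subset _ _).trans Finset.sdiff_subset
  have hdel := h.sdiff_add_card_le (hSB.trans (Finset.subset_insert i B))
    fun s hs => (Finset.mem_filter.1 hs).2
  have hB := h.union_le_add_card (B \ S) S
  rw [Finset.sdiff_union_of_subset hSB] at hB
  have hiS : insert i B \ S = insert i (B \ S) :=
    Finset.insert_sdiff_of_notMem B fun hi => hiB (hSB hi)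
  rw [hiS] at hdel
  have hunion : ρ (A.erase i ∪ (B \ S)) ≤ ρ (A.erase i) := by
    refine h.union_le_of_forall_insert_le fun t ht => ?_
    obtain ⟨htB, htS⟩ := Finset.mem_sdiff.1 ht
    by_cases htA : t ∈ A
    · have hti : t ≠ i := fun hti => hiB (hti ▸ htB)
      rw [Finset.insert_eq_of_mem (Finset.mem_erase.2 ⟨hti, htA⟩)]
    · have htBA := Finset.mem_sdiff.2 ⟨htB, htA⟩
      exact (hj t htBA).resolve_right fun hcol => htS (Finset.mem_filter.2 ⟨htBA, hcol⟩)
  have hdim := h.insert_add_le_of_subset i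
    (Finset.subset_union_right : B \ S ⊆ A.erase i ∪ (B \ S))
  have hA : ρ A ≤ ρ (insert i (A.erase i ∪ (B \ S))) := h.mono (by grind)
  omega

/-- If `|A| = |B|` and every element of `B \ A` is spanned by `A - i` and is a coloop of `B + i`,
then the marginal rank of `i` over `A - i` is smaller than over `B`. -/
lemma add_lt_of_spanned_and_coloop (h : IsMatroidRank ρ) {A B : Finset α} {i : α}
    (hAB : A.card = B.card) (hi : i ∈ A \ B)
    (hspan : ∀ j ∈ B \ A, ρ (insert j (A.erase i)) ≤ ρ (A.erase i))
    (hcol : ∀ j ∈ B \ A, ρ ((insert i B).erase j) + 1 ≤ ρ (insert i B)) :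
    ρ A + ρ B < ρ (A.erase i) + ρ (insert i B) := by
  obtain ⟨hiA, hiB⟩ := Finset.mem_sdiff.1 hi
  have hdel := h.sdiff_add_card_le
    (Finset.sdiff_subset.trans (Finset.subset_insert i B) : B \ A ⊆ insert i B) hcol
  have hinter : insert i B \ (B \ A) = insert i (A ∩ B) := by grind
  have hA := h.union_le_add_card (insert i (A ∩ B)) ((A \ B).erase i)
  have hdecomp : insert i (A ∩ B) ∪ (A \ B).erase i = A := by grind
  rw [hinter] at hdel
  rw [hdecomp, Finset.card_erase_of_mem hi, Finset.card_sdiff_comm hAB] at hA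
  have hpos : 0 < (A \ B).card := Finset.card_pos.2 ⟨i, hi⟩
  rw [Finset.card_sdiff_comm hAB] at hpos
  have hBA := h.union_le_of_forall_insert_le hspan
  have hB : ρ B ≤ ρ (A.erase i ∪ (B \ A)) := h.mono (by grind)
  omega

/-- The rank function of a matroid satisfies the Dress–Wenzel exchange axiom (maximum convention)
on sets of equal cardinality. -/
theorem exists_exchange (h : IsMatroidRank ρ) {A B : Finset α} {i : α}
    (hAB : A.card = B.card) (hi : i ∈ A \ B) :
    ∃ j ∈ B \ A, ρ A + ρ B ≤ ρ (insert j (A.erase i)) + ρ (insert i (B.erase j)) := by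
  obtain ⟨hiA, hiB⟩ := Finset.mem_sdiff.1 hi
  by_contra! hfail
  have hne : (B \ A).Nonempty := by
    rw [← Finset.card_pos, Finset.card_sdiff_comm hAB.symm]
    exact Finset.card_pos.2 ⟨i, hi⟩
  have hfail' : ∀ j ∈ B \ A,
      ρ (insert j (A.erase i)) + ρ ((insert i B).erase j) < ρ A + ρ B := by
    intro j hj
    have hij : i ≠ j := fun hij => hiB (hij ▸ (Finset.mem_sdiff.1 hj).1)
    rw [Finset.erase_insert_of_ne hij]
    exact hfail j hj
  have hAi := h.insert_le i (A.erase i)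
  rw [Finset.insert_erase hiA] at hAi
  have hAm : ρ (A.erase i) ≤ ρ A := h.mono (Finset.erase_subset i A)
  have hBm : ρ B ≤ ρ (insert i B) := h.mono (Finset.subset_insert i B)
  have hadd : ∀ j, ρ (A.erase i) ≤ ρ (insert j (A.erase i)) :=
    fun j => h.mono (Finset.subset_insert j _)
  have hdel : ∀ j ∈ B \ A, ρ (insert i B) ≤ ρ ((insert i B).erase j) + 1 := by
    intro j hj
    have := h.insert_le j ((insert i B).erase j)
    rwa [Finset.insert_erase (Finset.mem_insert_of_mem (Finset.mem_sdiff.1 hj).1)] at this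
  by_cases hgain : ρ A + ρ B ≤ ρ (A.erase i) + ρ (insert i B)
  · refine absurd (h.add_lt_of_spanned_and_coloop hAB hi ?_ ?_) ?_
    · intro j hj
      have := hfail' j hj
      have := hdel j hj
      omega
    · intro j hj
      have := hfail' j hj
      have := hadd j
      omega
    · obtain ⟨j, hj⟩ := hne
      have := hfail' j hj
      have := hdel j hj
      have := hadd j
      omega
  · have := h.le_erase_of_spanned_or_coloop (A := A) hiB (by omega) fun j hj => by
      have := hfail' j hj
      omega
    omega

end IsMatroidRank

lemma Matroid.isMatroidRank_toNat_eRk {α : Type*} [DecidableEq α] (N : Matroid α) :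
    IsMatroidRank fun X : Finset α => (N.eRk X).toNat := by
  have hcoe (X : Finset α) : ((N.eRk X).toNat : ℕ∞) = N.eRk X :=
    ENat.natCast_toNat (Matroid.eRk_ne_top_iff.2 (N.isRkFinite_of_finite X.finite_toSet))
  refine ⟨fun X Y hXY => ?_, fun e X => ?_, fun X Y => ?_⟩
  · rw [← Nat.cast_le (α := ℕ∞), hcoe, hcoe]
    exact N.eRk_mono (Finset.coe_subset.2 hXY)
  · rw [← Nat.cast_le (α := ℕ∞), Nat.cast_add, hcoe, hcoe, Finset.coe_insert, Nat.cast_one]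
    exact N.eRk_insert_le_add_one e X
  · rw [← Nat.cast_le (α := ℕ∞), Nat.cast_add, Nat.cast_add, hcoe, hcoe, hcoe, hcoe,
      Finset.coe_inter, Finset.coe_union]
    exact N.eRk_inter_add_eRk_union_le X Y

/-- The largest intersection of a set with a member of a family satisfying basis exchange is a
matroid rank function. -/
lemma isMatroidRank_sup_card_inter {α : Type*} [Fintype α] [DecidableEq α]
    {M : Finset (Finset α)} (hMne : M.Nonempty)
    (hexch : ∀ B ∈ M, ∀ B' ∈ M, ∀ i ∈ B \ B', ∃ j ∈ B' \ B, insert j (B.erase i) ∈ M) :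
    IsMatroidRank fun X => M.sup fun B => (X ∩ B).card := by
  let N : Matroid α := Matroid.ofIsBaseOfFinite Set.finite_univ (fun S => ∃ B ∈ M, (B : Set α) = S)
    (let ⟨B, hB⟩ := hMne; ⟨B, B, hB, rfl⟩)
    (by
      rintro _ _ ⟨B, hB, rfl⟩ ⟨B', hB', rfl⟩ i hi
      obtain ⟨j, hj, hjM⟩ := hexch B hB B' hB' i (by simpa using hi)
      exact ⟨j, by simpa using hj, _, hjM, by simp⟩)
    (fun _ _ => Set.subset_univ _)
  have hbase (S : Set α) : N.IsBase S ↔ ∃ B ∈ M, (B : Set α) = S := Iff.rfl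
  convert N.isMatroidRank_toNat_eRk with X
  have hcoe : ((N.eRk X).toNat : ℕ∞) = N.eRk X :=
    ENat.natCast_toNat (Matroid.eRk_ne_top_iff.2 (N.isRkFinite_of_finite X.finite_toSet))
  apply le_antisymm
  · refine Finset.sup_le fun B hB => ?_
    have hind : N.Indep (↑(X ∩ B) : Set α) :=
      ((hbase B).2 ⟨B, hB, rfl⟩).indep.subset (by simp)
    have := hind.encard_le_eRk_of_subset (X := (X : Set α)) (by simp)
    rwa [Set.encard_coe_eq_coe_finsetCard, ← hcoe, Nat.cast_le] at this
  · rw [← Nat.cast_le (α := ℕ∞), hcoe, Matroid.eRk_le_iff]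
    intro I hIX hI
    obtain ⟨_, hB, hIB⟩ := hI.exists_isBase_superset
    obtain ⟨B, hBM, rfl⟩ := (hbase _).1 hB
    calc I.encard ≤ (↑(X ∩ B) : Set α).encard := Set.encard_le_encard (by simp [hIX, hIB])
      _ = ((X ∩ B).card : ℕ∞) := Set.encard_coe_eq_coe_finsetCard _
      _ ≤ _ := Nat.cast_le.2 (Finset.le_sup (f := fun B => (X ∩ B).card) hBM)

/-- Let `M` be the set of bases of a matroid of rank `r` on `{1,…,n}` (a
nonempty collection of `r`-element subsets satisfying the basis exchange
axiom). The corank function `v_M(B) = r - max_{B' ∈ M} |B ∩ B'|` satisfies the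
Dress–Wenzel valuated matroid exchange axiom (minimum convention) on the
collection of all `r`-element subsets of `{1,…,n}`. -/
theorem corank_is_valuation (n r : ℕ)
    (M : Finset (Finset (Fin n))) (hMne : M.Nonempty)
    (hcard : ∀ B ∈ M, B.card = r)
    (hexch : ∀ B ∈ M, ∀ B' ∈ M, ∀ i ∈ B \ B',
      ∃ j ∈ B' \ B, insert j (B.erase i) ∈ M)
    (v : Finset (Fin n) → ℝ)
    (hv : ∀ B : Finset (Fin n), B.card = r →
      v B = (r : ℝ) - M.sup' hMne (fun B' => ((B ∩ B').card : ℝ))) :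
    ∀ A B : Finset (Fin n), A.card = r → B.card = r → ∀ i ∈ A \ B,
      ∃ j ∈ B \ A,
        v (insert j (A.erase i)) + v (insert i (B.erase j)) ≤ v A + v B := by
  intro A B hA hB i hi
  obtain ⟨hiA, hiB⟩ := Finset.mem_sdiff.1 hi
  have hv' (X : Finset (Fin n)) (hX : X.card = r) :
      v X = r - ((M.sup fun B' => (X ∩ B').card : ℕ) : ℝ) := by
    rw [hv X hX, ← Finset.sup'_eq_sup hMne,
      Finset.apply_sup'_eq_sup'_comp hMne (fun k : ℕ => (k : ℝ)) Nat.cast_max]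
    rfl
  obtain ⟨j, hj, hle⟩ :=
    (isMatroidRank_sup_card_inter hMne hexch).exists_exchange (hA.trans hB.symm) hi
  obtain ⟨hjB, hjA⟩ := Finset.mem_sdiff.1 hj
  refine ⟨j, hj, ?_⟩
  have hA' : (insert j (A.erase i)).card = r := by
    rw [Finset.card_insert_of_notMem fun h => hjA (Finset.mem_of_mem_erase h),
      Finset.card_erase_add_one hiA, hA]
  have hB' : (insert i (B.erase j)).card = r := by
    rw [Finset.card_insert_of_notMem fun h => hiB (Finset.mem_of_mem_erase h),
      Finset.card_erase_add_one hjB, hB]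
  rw [hv' _ hA, hv' _ hB, hv' _ hA', hv' _ hB']
  have hleR : (_ : ℝ) ≤ _ := Nat.cast_le.2 hle
  simp only [Nat.cast_add] at hleR
  linarith
end
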